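/- Let n ≥ 1, k ≥ 1, p ≥ 1. Then the sets b̃_{k,p}(n) and b̂_{k,p}(n) are in bijection; in particular |b̃_{k,p}(n)| = |b̂_{k,p}(n)|. -/

import Mathlib

open Equiv MeasureTheory ProbabilityTheory

noncomputable section

namespace RibbonNC

/-- The number of cycles `#(σ)` of a permutation, counted on the finite set `S`:
the number of orbits of `σ` meeting `S` (fixed points count as orbits). -/
def cyclesOn {α : Type*} (σ : Equiv.Perm α) (S : Finset α) : ℕ :=
  ((fun a => {b | σ.SameCycle a b}) '' (S : Set α)).ncard

/-- `σ` is a permutation of `S`: it fixes everything outside `S`. -/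
def IsPermOn {α : Type*} (σ : Equiv.Perm α) (S : Finset α) : Prop :=
  ∀ a ∉ S, σ a = a

/-- `σ` is a pairing of `S`: a fixed-point-free involution of `S`, fixing everything
outside `S`. -/
def IsPairingOn {α : Type*} (σ : Equiv.Perm α) (S : Finset α) : Prop :=
  σ * σ = 1 ∧ (∀ a ∈ S, σ a ≠ a) ∧ IsPermOn σ S

/-- `π` is non-crossing with respect to `γ` on `S`: the subgroup generated by `π` and `γ`
acts transitively on `S`, and `#(π) + #(π⁻¹γ) + #(γ) = |S| + 2`. -/
def IsNoncrossingOn {α : Type*} (π γ : Equiv.Perm α) (S : Finset α) : Prop :=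
  (∀ a ∈ S, ∀ b ∈ S, ∃ σ ∈ Subgroup.closure ({π, γ} : Set (Equiv.Perm α)), σ a = b) ∧
  cyclesOn π S + cyclesOn (π⁻¹ * γ) S + cyclesOn γ S = S.card + 2

/-- `[n] = {1, …, n}`, as a finset of integers. -/
def posSet (n : ℕ) : Finset ℤ := Finset.Icc 1 (n : ℤ)

/-- `±[n] = {−n, …, −1} ∪ {1, …, n}`, as a finset of integers. -/
def pmSet (n : ℕ) : Finset ℤ := Finset.Icc (-(n : ℤ)) (n : ℤ) \ {0}

/-- The cyclic permutation `γ_n = (1, 2, …, n)` of `[n]`. -/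
def gammaZ (n : ℕ) : Equiv.Perm ℤ := ((List.range n).map fun i => ((i : ℤ) + 1)).formPerm

/-- The permutation `γ̃_n = (1, 2, …, n)(−n, …, −2, −1)` of `±[n]`. -/
def gammaTildeZ (n : ℕ) : Equiv.Perm ℤ :=
  gammaZ n * ((List.range n).map fun i => ((i : ℤ) - (n : ℤ))).formPerm

/-- The involution `τ₀ : a ↦ −a` on `±[n]`, fixing everything outside. -/
def tau0 (n : ℕ) : Equiv.Perm ℤ :=
  ((List.range n).map fun i => Equiv.swap ((i : ℤ) + 1) (-((i : ℤ) + 1))).prod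

/-- The involution `τ₂` on `±[n]`, pairing `−k` with `k+1` for `1 ≤ k ≤ n−1`, and `−n`
with `1`. -/
def tau2 (n : ℕ) : Equiv.Perm ℤ :=
  ((List.range (n - 1)).map fun i => Equiv.swap (-((i : ℤ) + 1)) ((i : ℤ) + 2)).prod *
    Equiv.swap (-(n : ℤ)) 1

/-- The `δ`-condition for a permutation of `S = ±[n]`: no cycle of the form `(r, −r)`,
and together with every cycle `(r₁, …, r_s)`, the cycle `(−r_s, …, −r₁)` also occurs
(the latter is equivalent to `π(−a) = −π⁻¹(a)` for all `a`). -/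
def IsDeltaOn (π : Equiv.Perm ℤ) (S : Finset ℤ) : Prop :=
  (∀ r ∈ S, ¬(π r = -r ∧ π (-r) = r)) ∧ ∀ a : ℤ, π (-a) = -(π⁻¹ a)

/-- `a_g(n) = {π ∈ P₂(n) : #(π⁻¹γ_n) = n/2 + 1 − 2g}`. -/
def aSet (g n : ℕ) : Set (Equiv.Perm ℤ) :=
  {π | IsPairingOn π (posSet n) ∧ cyclesOn (π⁻¹ * gammaZ n) (posSet n) + 2 * g = n / 2 + 1}

/-- `b_k(n)`. -/
def bSet (k n : ℕ) : Set (Equiv.Perm ℤ) :=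
  {τ₁ | IsPairingOn τ₁ (pmSet n) ∧ cyclesOn (tau2 n * τ₁) (pmSet n) + 2 * k = n + 2 ∧
    tau0 n * τ₁ = τ₁ * tau0 n ∧ (∀ a ∈ pmSet n, (tau0 n * τ₁) a ≠ a) ∧
    ∃ a ∈ posSet n, τ₁ a ∈ posSet n}

/-- `NC₂^δ(n, −n)`, the symmetric non-crossing annular pairings of `±[n]`. -/
def ncDelta2 (n : ℕ) : Set (Equiv.Perm ℤ) :=
  {π | IsPairingOn π (pmSet n) ∧ IsNoncrossingOn π (gammaTildeZ n) (pmSet n) ∧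
    IsDeltaOn π (pmSet n)}

/-- `γ_{n,u,v} = γ_n · (u−1, v)`, with `(0, v)` read as `(n, v)` when `u = 1`. -/
def gammaUV (n : ℕ) (u v : ℤ) : Equiv.Perm ℤ :=
  gammaZ n * Equiv.swap (if u = 1 then (n : ℤ) else u - 1) v

/-- `NC₂^T_{u,v}(n)`. -/
def ncT2uv (n : ℕ) (u v : ℤ) : Set (Equiv.Perm ℤ) :=
  {π | IsPairingOn π (posSet n) ∧ IsNoncrossingOn π (gammaUV n u v) (posSet n) ∧
    π u = v ∧ ∀ a : ℤ, 1 ≤ a → a < u → π a ∈ posSet n ∧ ¬(u ≤ π a ∧ π a ≤ v)}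

/-- `NC₂^T(n)`. -/
def ncT2 (n : ℕ) : Set (Equiv.Perm ℤ) :=
  {π | ∃ u v : ℤ, 1 ≤ u ∧ u < v ∧ v < (n : ℤ) ∧ π ∈ ncT2uv n u v}

/-- `γ̃_{n,u,v} = γ̃_n · (−u, v−1) · (−v, u−1)`, with `(−v, 0)` read as `(−v, n)` when
`u = 1`. -/
def gammaTildeUV (n : ℕ) (u v : ℤ) : Equiv.Perm ℤ :=
  gammaTildeZ n * Equiv.swap (-u) (v - 1) *
    Equiv.swap (-v) (if u = 1 then (n : ℤ) else u - 1)

/-- `NC₂^K_{u,v}(n)`. -/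
def ncK2uv (n : ℕ) (u v : ℤ) : Set (Equiv.Perm ℤ) :=
  {π | IsPairingOn π (pmSet n) ∧ IsNoncrossingOn π (gammaTildeUV n u v) (pmSet n) ∧
    IsDeltaOn π (pmSet n) ∧ π u = -v ∧ ∀ a : ℤ, 1 ≤ a → a < u → π a ∈ posSet n}

/-- `NC₂^K(n)`. -/
def ncK2 (n : ℕ) : Set (Equiv.Perm ℤ) :=
  {π | ∃ u v : ℤ, 1 ≤ u ∧ u < v ∧ v < (n : ℤ) ∧ π ∈ ncK2uv n u v}

/-- The odd elements `{1, 3, …, 2n−1}` of `[2n]`. -/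
def oddPosSet (n : ℕ) : Finset ℤ := (posSet (2 * n)).filter fun a => Odd a

/-- `ã_{g,p}(n)`. -/
def aTildeSet (g p n : ℕ) : Set (Equiv.Perm ℤ) :=
  {π | π ∈ aSet g (2 * n) ∧ (∀ a ∈ posSet (2 * n), Even a → Odd (π a)) ∧
    cyclesOn (π⁻¹ * gammaZ (2 * n)) (oddPosSet n) = p}

/-- `B(n) = {1, 3, …, 2n−1} ∪ {−2, −4, …, −2n} ⊂ ±[2n]`. -/
def BSet (n : ℕ) : Finset ℤ :=
  (pmSet (2 * n)).filter fun a => (0 < a ∧ Odd a) ∨ (a < 0 ∧ Even a)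

/-- `W(n) = {2, 4, …, 2n} ∪ {−1, −3, …, −(2n−1)} ⊂ ±[2n]`. -/
def WSet (n : ℕ) : Finset ℤ :=
  (pmSet (2 * n)).filter fun a => (0 < a ∧ Even a) ∨ (a < 0 ∧ Odd a)

/-- `b̃_{k,p}(n)`. -/
def bTildeSet (k p n : ℕ) : Set (Equiv.Perm ℤ) :=
  {τ₁ | τ₁ ∈ bSet k (2 * n) ∧ (∀ a ∈ BSet n, τ₁ a ∈ BSet n) ∧
    cyclesOn (tau2 (2 * n) * τ₁) (WSet n) = 2 * p}

/-- `â_{g,p}(n) = {π ∈ S_{[n]} : #(π) = p, #(π⁻¹γ_n) = n − p + 1 − 2g}`. -/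
def aHatSet (g p n : ℕ) : Set (Equiv.Perm ℤ) :=
  {π | IsPermOn π (posSet n) ∧ cyclesOn π (posSet n) = p ∧
    cyclesOn (π⁻¹ * gammaZ n) (posSet n) + p + 2 * g = n + 1}

/-- `b̂_{k,p}(n)`. -/
def bHatSet (k p n : ℕ) : Set (Equiv.Perm ℤ) :=
  {τ₁ | IsPermOn τ₁ (pmSet n) ∧ cyclesOn τ₁ (pmSet n) = 2 * p ∧
    cyclesOn (gammaTildeZ n * τ₁) (pmSet n) + 2 * p + 2 * k = 2 * n + 2 ∧
    tau0 n * τ₁ * tau0 n = τ₁⁻¹ ∧ (∀ a ∈ pmSet n, (tau0 n * τ₁) a ≠ a) ∧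
    ∃ a ∈ posSet n, -(τ₁ a) ∈ posSet n}

/-- `ÑC₂^{δ,p}(2n, −2n)`. -/
def ncDelta2Tilde (p n : ℕ) : Set (Equiv.Perm ℤ) :=
  {π | π ∈ ncDelta2 (2 * n) ∧ (∀ a ∈ WSet n, π a ∈ BSet n) ∧
    cyclesOn (π⁻¹ * gammaTildeZ (2 * n)) (BSet n) = 2 * p}

/-- `ÑC₂^{T,p}(2n)`. -/
def ncT2Tilde (p n : ℕ) : Set (Equiv.Perm ℤ) :=
  {π | ∃ u v : ℤ, 1 ≤ u ∧ u < v ∧ v < (2 * n : ℤ) ∧ Odd (v - u) ∧ π ∈ ncT2uv (2 * n) u v ∧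
    (∀ a ∈ posSet (2 * n), Even a → Odd (π a)) ∧
    cyclesOn (π⁻¹ * gammaZ (2 * n)) (oddPosSet n) = p}

/-- `ÑC₂^{K,p}(2n)`. -/
def ncK2Tilde (p n : ℕ) : Set (Equiv.Perm ℤ) :=
  {π | ∃ u v : ℤ, 1 ≤ u ∧ u < v ∧ v < (2 * n : ℤ) ∧ Even (v - u) ∧ π ∈ ncK2uv (2 * n) u v ∧
    (∀ a ∈ WSet n, π a ∈ BSet n) ∧
    cyclesOn (π⁻¹ * gammaTildeZ (2 * n)) (BSet n) = 2 * p}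

/-- `NC^{T,p}(n)` (non-crossing annular permutations, toroidal case). -/
def ncTPerm (p n : ℕ) : Set (Equiv.Perm ℤ) :=
  {π | ∃ u v : ℤ, 1 ≤ u ∧ u < v ∧ v < (n : ℤ) ∧ IsPermOn π (posSet n) ∧
    IsNoncrossingOn π (gammaUV n u v) (posSet n) ∧ π⁻¹ u = v ∧
    cyclesOn π (posSet n) = p ∧
    ∀ a : ℤ, 1 ≤ a → a < u → π⁻¹ a ∈ posSet n ∧ ¬(u ≤ π⁻¹ a ∧ π⁻¹ a ≤ v)}

/-- `NC^{δ,p}(n, −n)` (symmetric non-crossing annular permutations). -/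
def ncDeltaPerm (p n : ℕ) : Set (Equiv.Perm ℤ) :=
  {π | IsPermOn π (pmSet n) ∧ IsNoncrossingOn π (gammaTildeZ n) (pmSet n) ∧
    IsDeltaOn π (pmSet n) ∧ cyclesOn π (pmSet n) = 2 * p}

/-- `NC^{K,p}(n)` (non-crossing annular permutations, Klein bottle case). -/
def ncKPerm (p n : ℕ) : Set (Equiv.Perm ℤ) :=
  {π | ∃ u v : ℤ, 1 ≤ u ∧ u < v ∧ v < (n : ℤ) ∧ IsPermOn π (pmSet n) ∧
    IsNoncrossingOn π (gammaTildeUV n u v) (pmSet n) ∧ IsDeltaOn π (pmSet n) ∧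
    π u = -v ∧ cyclesOn π (pmSet n) = 2 * p ∧
    ∀ a : ℤ, 1 ≤ a → a < u → π⁻¹ a ∈ posSet n}


theorem coe_list (l : List ℕ) :
    (do let a ← l; pure (a : ℤ) : List ℤ) = l.map (fun a : ℕ => (a : ℤ)) := by
  induction l with
  | nil => rfl
  | cons a l ih =>
    simp only [List.map_cons, ← ih]
    rfl

theorem tau0_def (n : ℕ) : tau0 n =
    ((List.range n).map fun i : ℕ => Equiv.swap ((i : ℤ) + 1) (-((i : ℤ) + 1))).prod := by
  rw [tau0, coe_list, List.map_map]
  rfl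

theorem tau2_def (n : ℕ) : tau2 n = ((List.range (n - 1)).map
    fun i : ℕ => Equiv.swap (-((i : ℤ) + 1)) ((i : ℤ) + 2)).prod * Equiv.swap (-(n : ℤ)) 1 := by
  rw [tau2, coe_list, List.map_map]
  rfl

theorem gammaTilde_def (n : ℕ) : gammaTildeZ n =
    ((List.range n).map fun i : ℕ => ((i : ℤ) + 1)).formPerm *
      ((List.range n).map fun i : ℕ => ((i : ℤ) + (-(n : ℤ)))).formPerm := by
  rw [gammaTildeZ, gammaZ, coe_list, List.map_map, List.map_map]
  rfl

theorem mem_pmSet (n : ℕ) (x : ℤ) : x ∈ pmSet n ↔ -(n : ℤ) ≤ x ∧ x ≤ n ∧ x ≠ 0 := by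
  simp [pmSet, and_assoc]

theorem mem_posSet (n : ℕ) (x : ℤ) : x ∈ posSet n ↔ 1 ≤ x ∧ x ≤ n := by
  simp [posSet]

theorem tau0_apply (n : ℕ) (x : ℤ) :
    tau0 n x = if -(n : ℤ) ≤ x ∧ x ≤ n then -x else x := by
  induction n generalizing x with
  | zero =>
    simp only [tau0_def, List.range_zero, List.map_nil, List.prod_nil, Equiv.Perm.coe_one, id]
    split_ifs with h
    · push_cast at h; omega
    · rfl
  | succ m ih =>
    have h : tau0 (m + 1) = tau0 m * Equiv.swap ((m : ℤ) + 1) (-((m : ℤ) + 1)) := by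
      simp [tau0_def, List.range_succ]
    rw [h, Equiv.Perm.mul_apply, ih, Equiv.swap_apply_def]
    push_cast
    split_ifs <;> omega

theorem tau2_aux (m : ℕ) (x : ℤ) :
    ((List.range m).map fun i : ℕ => Equiv.swap (-((i : ℤ) + 1)) ((i : ℤ) + 2)).prod x =
      if (-(m : ℤ) ≤ x ∧ x ≤ -1) ∨ (2 ≤ x ∧ x ≤ (m : ℤ) + 1) then 1 - x else x := by
  induction m generalizing x with
  | zero =>
    simp only [List.range_zero, List.map_nil, List.prod_nil, Equiv.Perm.coe_one, id]
    split_ifs with h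
    · push_cast at h; omega
    · rfl
  | succ m ih =>
    rw [List.range_succ, List.map_append, List.prod_append, Equiv.Perm.mul_apply, ih]
    simp only [List.map_cons, List.map_nil, List.prod_cons, List.prod_nil, mul_one]
    rw [Equiv.swap_apply_def]
    push_cast
    split_ifs <;> omega

theorem tau2_apply (n : ℕ) (hn : 1 ≤ n) (x : ℤ) :
    tau2 n x = if x = 1 then -(n : ℤ) else if x = -(n : ℤ) then 1 else
      if (-(n : ℤ) ≤ x ∧ x ≤ -1) ∨ (2 ≤ x ∧ x ≤ (n : ℤ)) then 1 - x else x := by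
  obtain ⟨m, rfl⟩ : ∃ m, n = m + 1 := ⟨n - 1, by omega⟩
  rw [tau2_def, Equiv.Perm.mul_apply, tau2_aux, Equiv.swap_apply_def]
  simp only [Nat.add_sub_cancel]
  push_cast
  split_ifs <;> omega

theorem formPerm_shift (n : ℕ) (c x : ℤ) :
    ((List.range n).map fun i : ℕ => ((i : ℤ) + c)).formPerm x =
      if c ≤ x ∧ x < c + n - 1 then x + 1 else
      if x = c + n - 1 ∧ 1 ≤ n then c else x := by
  set l := (List.range n).map fun i : ℕ => ((i : ℤ) + c) with hl
  have hlen : l.length = n := by simp [hl]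
  have hnd : l.Nodup := by
    refine List.Nodup.map ?_ List.nodup_range
    intro a b h
    simpa using h
  by_cases hx : c ≤ x ∧ x < c + n
  · obtain ⟨i, hi⟩ : ∃ i : ℕ, x = i + c := ⟨(x - c).toNat, by omega⟩
    have hin : i < n := by omega
    have hgi : ∀ (j : ℕ) (hj : j < l.length), l[j] = j + c := by
      intro j hj
      simp [hl]
    have := List.formPerm_apply_getElem l hnd i (by omega)
    rw [hgi, hgi, hlen] at this
    rw [hi, this]
    by_cases h : i + 1 = n
    · rw [h, Nat.mod_self]
      split_ifs <;> push_cast <;> omega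
    · rw [Nat.mod_eq_of_lt (by omega)]
      split_ifs <;> push_cast <;> omega
  · rw [List.formPerm_apply_of_notMem]
    · split_ifs <;> omega
    · simp only [hl, List.mem_map, List.mem_range, not_exists]
      intro a ha
      omega

theorem gammaTilde_eq (n : ℕ) (hn : 1 ≤ n) : gammaTildeZ n = tau2 n * tau0 n := by
  ext x
  rw [gammaTilde_def, Equiv.Perm.mul_apply, Equiv.Perm.mul_apply, formPerm_shift, formPerm_shift, tau0_apply,
    tau2_apply n hn]
  split_ifs <;> omega

theorem tau0_sq (n : ℕ) : tau0 n * tau0 n = 1 := by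
  ext x
  simp only [Equiv.Perm.mul_apply, tau0_apply, Equiv.Perm.one_apply]
  split_ifs <;> omega

/-- The embedding of `±[n]` onto `W(n)`. -/
def eW : ℤ ↪ ℤ where
  toFun x := if 0 < x then 1 - 2 * x else -2 * x
  inj' := by
    intro a b h
    simp only at h
    split_ifs at h <;> omega

/-- The embedding of `±[n]` onto `B(n)`. -/
def eB : ℤ ↪ ℤ where
  toFun x := - eW x
  inj' := by
    intro a b h
    exact eW.injective (neg_injective h)

theorem eW_apply (x : ℤ) : eW x = if 0 < x then 1 - 2 * x else -2 * x := rfl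

theorem eB_apply (x : ℤ) : eB x = - eW x := rfl

theorem cover (y : ℤ) : (∃ x, y = eW x) ∨ ∃ x, y = eB x := by
  simp only [eB_apply, eW_apply]
  rcases Int.even_or_odd' y with ⟨t, h | h⟩ <;> rcases lt_or_ge 0 y with h0 | h0
  · left; exact ⟨-t, by split_ifs <;> omega⟩
  · right; exact ⟨t, by split_ifs <;> omega⟩
  · right; exact ⟨t + 1, by split_ifs <;> omega⟩
  · left; exact ⟨-t, by split_ifs <;> omega⟩

theorem eW_eq_eB {x y : ℤ} (h : eW x = eB y) : x = 0 ∧ y = 0 := by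
  simp only [eB_apply, eW_apply] at h
  split_ifs at h <;> omega

theorem eW_mem_pm (n : ℕ) (x : ℤ) : eW x ∈ pmSet (2 * n) ↔ x ∈ pmSet n := by
  simp only [mem_pmSet, eW_apply]
  push_cast
  split_ifs <;> omega

theorem eB_mem_pm (n : ℕ) (x : ℤ) : eB x ∈ pmSet (2 * n) ↔ x ∈ pmSet n := by
  simp only [mem_pmSet, eB_apply, eW_apply]
  push_cast
  split_ifs <;> omega

theorem eW_mem_W (n : ℕ) (x : ℤ) : eW x ∈ WSet n ↔ x ∈ pmSet n := by
  rw [WSet, Finset.mem_filter, eW_mem_pm]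
  refine and_iff_left_of_imp fun h => ?_
  rw [mem_pmSet] at h
  rw [eW_apply, Int.even_iff, Int.odd_iff]
  split_ifs <;> omega

theorem eB_mem_B (n : ℕ) (x : ℤ) : eB x ∈ BSet n ↔ x ∈ pmSet n := by
  rw [BSet, Finset.mem_filter, eB_mem_pm]
  refine and_iff_left_of_imp fun h => ?_
  rw [mem_pmSet] at h
  rw [eB_apply, eW_apply, Int.even_iff, Int.odd_iff]
  split_ifs <;> omega

theorem zero_notMem_pm (n : ℕ) : (0 : ℤ) ∉ pmSet n := by simp [mem_pmSet]

theorem eW_notMem_B (n : ℕ) (x : ℤ) : eW x ∉ BSet n := by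
  rw [BSet, Finset.mem_filter, eW_apply, Int.even_iff, Int.odd_iff]
  split_ifs <;> omega

theorem eB_notMem_W (n : ℕ) (x : ℤ) : eB x ∉ WSet n := by
  rw [WSet, Finset.mem_filter, eB_apply, eW_apply, Int.even_iff, Int.odd_iff]
  split_ifs <;> omega

theorem WSet_eq (n : ℕ) : WSet n = (pmSet n).map eW := by
  ext y
  rcases cover y with ⟨x, rfl⟩ | ⟨x, rfl⟩
  · simp [eW_mem_W]
  · refine ⟨fun h => absurd h (eB_notMem_W n x), fun h => ?_⟩
    obtain ⟨z, hz, hzx⟩ := Finset.mem_map.1 h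
    rw [(eW_eq_eB hzx).1] at hz
    exact absurd hz (zero_notMem_pm n)

theorem BSet_eq (n : ℕ) : BSet n = (pmSet n).map eB := by
  ext y
  rcases cover y with ⟨x, rfl⟩ | ⟨x, rfl⟩
  · refine ⟨fun h => absurd h (eW_notMem_B n x), fun h => ?_⟩
    obtain ⟨z, hz, hzx⟩ := Finset.mem_map.1 h
    rw [(eW_eq_eB hzx.symm).2] at hz
    exact absurd hz (zero_notMem_pm n)
  · simp [eB_mem_B]

theorem pm_eq_union (n : ℕ) : pmSet (2 * n) = WSet n ∪ BSet n := by
  ext y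
  rw [Finset.mem_union]
  rcases cover y with ⟨x, rfl⟩ | ⟨x, rfl⟩
  · simp [eW_mem_W, eW_mem_pm, eW_notMem_B]
  · simp [eB_mem_B, eB_mem_pm, eB_notMem_W]

/-- The orbit of `ι a` under a permutation semiconjugate to `σ` along `ι`. -/
theorem orbit_map (σ σ' : Equiv.Perm ℤ) (ι : ℤ ↪ ℤ) (h : ∀ x, σ' (ι x) = ι (σ x)) (a : ℤ) :
    {b | σ'.SameCycle (ι a) b} = ι '' {b | σ.SameCycle a b} := by
  have hinv : ∀ x, σ'⁻¹ (ι x) = ι (σ⁻¹ x) := by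
    intro x
    rw [Equiv.Perm.inv_eq_iff_eq, h]
    simp
  have hz : ∀ (i : ℤ) x, (σ' ^ i) (ι x) = ι ((σ ^ i) x) := by
    intro i
    induction i using Int.induction_on with
    | zero => intro x; simp
    | succ i ih =>
      intro x
      rw [zpow_add_one, zpow_add_one, Equiv.Perm.mul_apply, Equiv.Perm.mul_apply, h, ih]
    | pred i ih =>
      intro x
      rw [zpow_sub_one, zpow_sub_one, Equiv.Perm.mul_apply, Equiv.Perm.mul_apply, hinv, ih]
  ext b
  constructor
  · rintro ⟨i, rfl⟩
    exact ⟨(σ ^ i) a, ⟨i, rfl⟩, (hz i a).symm⟩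
  · rintro ⟨c, ⟨i, rfl⟩, rfl⟩
    exact ⟨i, hz i a⟩

theorem cyclesOn_map (σ σ' : Equiv.Perm ℤ) (ι : ℤ ↪ ℤ) (h : ∀ x, σ' (ι x) = ι (σ x))
    (S : Finset ℤ) : cyclesOn σ' (S.map ι) = cyclesOn σ S := by
  unfold cyclesOn
  rw [Finset.coe_map, Set.image_image]
  simp only [orbit_map σ σ' ι h]
  rw [← Set.image_image (fun s => ι '' s), Set.ncard_image_of_injective]
  exact Set.image_injective.2 ι.injective

theorem cyclesOn_union (σ s t : Equiv.Perm ℤ) (n : ℕ) (hW : ∀ x, σ (eW x) = eW (s x))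
    (hB : ∀ x, σ (eB x) = eB (t x)) :
    cyclesOn σ (pmSet (2 * n)) = cyclesOn s (pmSet n) + cyclesOn t (pmSet n) := by
  rw [← cyclesOn_map s σ eW hW, ← cyclesOn_map t σ eB hB, pm_eq_union, WSet_eq, BSet_eq]
  unfold cyclesOn
  rw [Finset.coe_union, Set.image_union]
  refine Set.ncard_union_eq ?_ ((Finset.finite_toSet _).image _) ((Finset.finite_toSet _).image _)
  rw [Set.disjoint_left]
  rintro A ⟨a, ha, rfl⟩ ⟨b, hb, hab⟩
  obtain ⟨x, hx, rfl⟩ := Finset.mem_map.1 (Finset.mem_coe.1 ha)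
  obtain ⟨y, hy, rfl⟩ := Finset.mem_map.1 (Finset.mem_coe.1 hb)
  have h1 : eW x ∈ {b | σ.SameCycle (eW x) b} := Equiv.Perm.SameCycle.refl _ _
  simp only at hab
  rw [← hab, orbit_map t σ eB hB] at h1
  obtain ⟨z, hz, hzx⟩ := h1
  rw [(eW_eq_eB hzx.symm).1] at hx
  exact zero_notMem_pm n hx

theorem tau0_eW (n : ℕ) (x : ℤ) (hx : x ∈ pmSet n) : tau0 (2 * n) (eW x) = eB x := by
  rw [mem_pmSet] at hx
  rw [tau0_apply, eB_apply, eW_apply]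
  push_cast
  split_ifs <;> omega

theorem tau0_eB (n : ℕ) (x : ℤ) (hx : x ∈ pmSet n) : tau0 (2 * n) (eB x) = eW x := by
  rw [mem_pmSet] at hx
  rw [tau0_apply, eB_apply, eW_apply]
  push_cast
  split_ifs <;> omega

theorem tau0_notMem (n : ℕ) (x : ℤ) (hx : x ∉ pmSet n) : tau0 n x = x := by
  rw [mem_pmSet] at hx
  rw [tau0_apply]
  split_ifs <;> omega

theorem tau0_mem (n : ℕ) (x : ℤ) (hx : x ∈ pmSet n) : tau0 n x = -x := by
  rw [mem_pmSet] at hx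
  rw [tau0_apply]
  split_ifs <;> omega

theorem tau2_eW (n : ℕ) (hn : 1 ≤ n) (x : ℤ) : tau2 (2 * n) (eW x) = eW (tau0 n x) := by
  rw [tau2_apply _ (by omega), tau0_apply]
  simp only [eW_apply]
  push_cast
  split_ifs <;> omega

theorem tau2_eB (n : ℕ) (hn : 1 ≤ n) (x : ℤ) : tau2 (2 * n) (eB x) = eB (tau2 n x) := by
  rw [tau2_apply _ (by omega), tau2_apply n hn]
  simp only [eB_apply, eW_apply]
  push_cast
  split_ifs <;> omega

/-- `τ` acts on both copies `W` and `B` as `ρ`. -/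
def Rel (τ ρ : Equiv.Perm ℤ) : Prop :=
  ∀ x, τ (eW x) = eW (ρ x) ∧ τ (eB x) = eB (ρ x)

theorem Rel.unique {τ τ' ρ : Equiv.Perm ℤ} (h : Rel τ ρ) (h' : Rel τ' ρ) : τ = τ' := by
  ext y
  rcases cover y with ⟨x, rfl⟩ | ⟨x, rfl⟩
  · rw [(h x).1, (h' x).1]
  · rw [(h x).2, (h' x).2]

theorem Rel.unique_right {τ ρ ρ' : Equiv.Perm ℤ} (h : Rel τ ρ) (h' : Rel τ ρ') : ρ = ρ' := by
  ext x
  exact eW.injective ((h x).1.symm.trans (h' x).1)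

theorem permOn_mem {σ : Equiv.Perm ℤ} {S : Finset ℤ} (h : IsPermOn σ S) (x : ℤ) :
    σ x ∈ S ↔ x ∈ S := by
  constructor
  · intro hx
    by_contra hc
    rw [h x hc] at hx
    exact hc hx
  · intro hx
    by_contra hc
    have := σ.injective (h _ hc)
    rw [this] at hc
    exact hc hx

/-- Doubling of a permutation of `±[n]` to one of `±[2n]`. -/
def dbl (ρ : Equiv.Perm ℤ) : Equiv.Perm ℤ := ρ.viaEmbedding eW * ρ.viaEmbedding eB

theorem rel_dbl (ρ : Equiv.Perm ℤ) (h0 : ρ 0 = 0) : Rel (dbl ρ) ρ := by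
  intro x
  have hne : ∀ y : ℤ, y ≠ 0 → ρ y ≠ 0 := fun y hy h => hy (ρ.injective (h.trans h0.symm))
  have e0 : eB 0 = eW 0 := by simp [eB_apply, eW_apply]
  have hB : ρ.viaEmbedding eB (eW x) = eW x := by
    by_cases hx : x = 0
    · rw [hx, ← e0, Equiv.Perm.viaEmbedding_apply, h0]
    · refine Equiv.Perm.viaEmbedding_apply_of_notMem _ _ _ ?_
      rintro ⟨y, hy⟩
      exact hx (eW_eq_eB hy.symm).1
  have hW : ρ.viaEmbedding eW (eB (ρ x)) = eB (ρ x) := by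
    by_cases hx : ρ x = 0
    · rw [hx, e0, Equiv.Perm.viaEmbedding_apply, h0]
    · refine Equiv.Perm.viaEmbedding_apply_of_notMem _ _ _ ?_
      rintro ⟨y, hy⟩
      exact hx (eW_eq_eB hy).2
  constructor
  · rw [dbl, Equiv.Perm.mul_apply, hB, Equiv.Perm.viaEmbedding_apply]
  · rw [dbl, Equiv.Perm.mul_apply, Equiv.Perm.viaEmbedding_apply, hW]

theorem rel_permOn {τ ρ : Equiv.Perm ℤ} (n : ℕ) (h : Rel τ ρ) :
    IsPermOn τ (pmSet (2 * n)) ↔ IsPermOn ρ (pmSet n) := by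
  constructor
  · intro H x hx
    apply eW.injective
    rw [← (h x).1]
    exact H _ (by rwa [eW_mem_pm])
  · intro H y hy
    rcases cover y with ⟨x, rfl⟩ | ⟨x, rfl⟩
    · rw [eW_mem_pm] at hy
      rw [(h x).1, H x hy]
    · rw [eB_mem_pm] at hy
      rw [(h x).2, H x hy]

theorem rel_sq {τ ρ : Equiv.Perm ℤ} (h : Rel τ ρ) : τ * τ = 1 ↔ ρ * ρ = 1 := by
  constructor
  · intro H
    ext x
    apply eW.injective
    rw [Equiv.Perm.mul_apply, ← (h _).1, ← (h _).1, ← Equiv.Perm.mul_apply, H]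
    rfl
  · intro H
    have H' : ∀ x, ρ (ρ x) = x := fun x => by rw [← Equiv.Perm.mul_apply, H]; rfl
    ext y
    rcases cover y with ⟨x, rfl⟩ | ⟨x, rfl⟩
    · rw [Equiv.Perm.mul_apply, (h _).1, (h _).1, H']; rfl
    · rw [Equiv.Perm.mul_apply, (h _).2, (h _).2, H']; rfl

theorem rel_fix {τ ρ : Equiv.Perm ℤ} (n : ℕ) (h : Rel τ ρ) :
    (∀ a ∈ pmSet (2 * n), τ a ≠ a) ↔ ∀ a ∈ pmSet n, ρ a ≠ a := by
  constructor
  · intro H x hx hc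
    apply H (eW x) (by rwa [eW_mem_pm])
    rw [(h x).1, hc]
  · intro H y hy hc
    rcases cover y with ⟨x, rfl⟩ | ⟨x, rfl⟩
    · rw [eW_mem_pm] at hy
      rw [(h x).1] at hc
      exact H x hy (eW.injective hc)
    · rw [eB_mem_pm] at hy
      rw [(h x).2] at hc
      exact H x hy (eB.injective hc)

/-- An injection-counting argument: if a permutation of `±[n]` maps a negative element to a
negative element, it maps a positive element to a positive element. -/
theorem neg_to_pos {ρ : Equiv.Perm ℤ} (n : ℕ) (hp : IsPermOn ρ (pmSet n)) (x : ℤ)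
    (hx : x ∈ pmSet n) (hx0 : x < 0) (hr : ρ x < 0) :
    ∃ a ∈ posSet n, ρ a ∈ posSet n := by
  by_contra! hc
  have hmaps : ∀ a ∈ posSet n, -(ρ a) ∈ posSet n := by
    intro a ha
    have h1 := hc a ha
    have h2 : a ∈ pmSet n := by rw [mem_pmSet]; rw [mem_posSet] at ha; omega
    have h3 := (permOn_mem hp a).2 h2
    rw [mem_pmSet] at h3
    rw [mem_posSet] at h1 ⊢
    omega
  have hsurj := Finset.surjOn_of_injOn_of_card_le (s := posSet n) (t := posSet n)
    (fun a => -(ρ a)) hmaps (fun a _ b _ h => ρ.injective (neg_injective h)) le_rfl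
  have h3 := (permOn_mem hp x).2 hx
  have h4 : -(ρ x) ∈ posSet n := by
    rw [mem_pmSet] at h3
    rw [mem_posSet]
    omega
  obtain ⟨a, ha, hax⟩ := hsurj h4
  have := ρ.injective (neg_injective hax)
  subst this
  rw [Finset.mem_coe, mem_posSet] at ha
  omega

theorem eW_pos (x : ℤ) : 0 < eW x ↔ x < 0 := by
  rw [eW_apply]; split_ifs <;> omega

theorem eB_pos (x : ℤ) : 0 < eB x ↔ 0 < x := by
  rw [eB_apply, eW_apply]; split_ifs <;> omega

theorem mem_posSet' (n : ℕ) (x : ℤ) : x ∈ posSet n ↔ x ∈ pmSet n ∧ 0 < x := by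
  rw [mem_posSet, mem_pmSet]; omega

theorem rel_pos {τ ρ : Equiv.Perm ℤ} (n : ℕ) (h : Rel τ ρ) (hp : IsPermOn ρ (pmSet n)) :
    (∃ a ∈ posSet (2 * n), τ a ∈ posSet (2 * n)) ↔ ∃ a ∈ posSet n, ρ a ∈ posSet n := by
  constructor
  · rintro ⟨y, hy, hty⟩
    rw [mem_posSet'] at hy hty
    rcases cover y with ⟨x, rfl⟩ | ⟨x, rfl⟩
    · rw [(h x).1] at hty
      rw [eW_mem_pm, eW_pos] at hy hty
      exact neg_to_pos n hp x hy.1 hy.2 hty.2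
    · rw [(h x).2] at hty
      rw [eB_mem_pm, eB_pos] at hy hty
      exact ⟨x, by rwa [mem_posSet'], by rwa [mem_posSet']⟩
  · rintro ⟨x, hx, hrx⟩
    rw [mem_posSet'] at hx hrx
    refine ⟨eB x, ?_, ?_⟩
    · rwa [mem_posSet', eB_mem_pm, eB_pos]
    · rwa [(h x).2, mem_posSet', eB_mem_pm, eB_pos]

theorem rel_comm {τ ρ : Equiv.Perm ℤ} (n : ℕ) (h : Rel τ ρ) (hp : IsPermOn ρ (pmSet n)) :
    tau0 (2 * n) * τ = τ * tau0 (2 * n) := by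
  ext y
  rw [Equiv.Perm.mul_apply, Equiv.Perm.mul_apply]
  by_cases hy : y ∈ pmSet (2 * n)
  · rcases cover y with ⟨x, rfl⟩ | ⟨x, rfl⟩
    · rw [eW_mem_pm] at hy
      rw [tau0_eW n x hy, (h x).1, (h x).2, tau0_eW n _ ((permOn_mem hp x).2 hy)]
    · rw [eB_mem_pm] at hy
      rw [tau0_eB n x hy, (h x).1, (h x).2, tau0_eB n _ ((permOn_mem hp x).2 hy)]
  · have hτ := (rel_permOn n h).2 hp
    rw [tau0_notMem _ y hy, hτ y hy, tau0_notMem _ y hy]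

theorem rel_tau0_fix {τ ρ : Equiv.Perm ℤ} (n : ℕ) (h : Rel τ ρ) (hp : IsPermOn ρ (pmSet n)) :
    ∀ a ∈ pmSet (2 * n), (tau0 (2 * n) * τ) a ≠ a := by
  intro y hy hc
  rw [Equiv.Perm.mul_apply] at hc
  rcases cover y with ⟨x, rfl⟩ | ⟨x, rfl⟩
  · rw [eW_mem_pm] at hy
    rw [(h x).1, tau0_eW n _ ((permOn_mem hp x).2 hy)] at hc
    exact zero_notMem_pm n ((eW_eq_eB hc.symm).1 ▸ hy)
  · rw [eB_mem_pm] at hy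
    rw [(h x).2, tau0_eB n _ ((permOn_mem hp x).2 hy)] at hc
    exact zero_notMem_pm n ((eW_eq_eB hc).2 ▸ hy)

theorem rel_BSet {τ ρ : Equiv.Perm ℤ} (n : ℕ) (h : Rel τ ρ) (hp : IsPermOn ρ (pmSet n)) :
    ∀ a ∈ BSet n, τ a ∈ BSet n := by
  intro y hy
  rcases cover y with ⟨x, rfl⟩ | ⟨x, rfl⟩
  · exact absurd hy (eW_notMem_B n x)
  · rw [eB_mem_B] at hy
    rw [(h x).2, eB_mem_B]
    exact (permOn_mem hp x).2 hy

theorem tau0_permOn (n : ℕ) : IsPermOn (tau0 n) (pmSet n) := fun x hx => tau0_notMem n x hx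

theorem tau0_tau0 (n : ℕ) (x : ℤ) : tau0 n (tau0 n x) = x := by
  rw [← Equiv.Perm.mul_apply, tau0_sq]; rfl

theorem hat_permOn (ρ : Equiv.Perm ℤ) (n : ℕ) :
    IsPermOn (tau0 n * ρ) (pmSet n) ↔ IsPermOn ρ (pmSet n) := by
  constructor
  · intro H x hx
    have := H x hx
    rw [Equiv.Perm.mul_apply] at this
    rw [← tau0_tau0 n (ρ x), this, tau0_notMem n x hx]
  · intro H x hx
    rw [Equiv.Perm.mul_apply, H x hx, tau0_notMem n x hx]

theorem hat_sq (ρ : Equiv.Perm ℤ) (n : ℕ) :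
    tau0 n * (tau0 n * ρ) * tau0 n = (tau0 n * ρ)⁻¹ ↔ ρ * ρ = 1 := by
  rw [← mul_assoc, tau0_sq, one_mul, eq_inv_iff_mul_eq_one, mul_assoc, ← mul_assoc (tau0 n),
    tau0_sq, one_mul]

theorem hat_pos (ρ : Equiv.Perm ℤ) (n : ℕ) (hp : IsPermOn ρ (pmSet n)) :
    (∃ a ∈ posSet n, -((tau0 n * ρ) a) ∈ posSet n) ↔ ∃ a ∈ posSet n, ρ a ∈ posSet n := by
  have : ∀ a ∈ posSet n, -((tau0 n * ρ) a) = ρ a := by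
    intro a ha
    rw [Equiv.Perm.mul_apply, tau0_mem n _ ((permOn_mem hp a).2 ((mem_posSet' n a).1 ha).1),
      neg_neg]
  constructor
  · rintro ⟨a, ha, h⟩
    exact ⟨a, ha, this a ha ▸ h⟩
  · rintro ⟨a, ha, h⟩
    exact ⟨a, ha, (this a ha).symm ▸ h⟩

theorem rel_main {τ ρ : Equiv.Perm ℤ} (n k p : ℕ) (hn : 1 ≤ n) (h : Rel τ ρ) :
    τ ∈ bTildeSet k p n ↔ tau0 n * ρ ∈ bHatSet k p n := by
  have hW : ∀ x, (tau2 (2 * n) * τ) (eW x) = eW ((tau0 n * ρ) x) := fun x => by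
    rw [Equiv.Perm.mul_apply, (h x).1, tau2_eW n hn]; rfl
  have hB : ∀ x, (tau2 (2 * n) * τ) (eB x) = eB ((gammaTildeZ n * (tau0 n * ρ)) x) := fun x => by
    rw [Equiv.Perm.mul_apply, (h x).2, tau2_eB n hn, gammaTilde_eq n hn, mul_assoc,
      ← mul_assoc (tau0 n), tau0_sq, one_mul]; rfl
  have c1 : cyclesOn (tau2 (2 * n) * τ) (WSet n) = cyclesOn (tau0 n * ρ) (pmSet n) := by
    rw [WSet_eq, cyclesOn_map _ _ _ hW]
  have c2 := cyclesOn_union _ _ _ n hW hB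
  have hfix : (∀ a ∈ pmSet n, (tau0 n * (tau0 n * ρ)) a ≠ a) ↔ ∀ a ∈ pmSet n, ρ a ≠ a := by
    rw [← mul_assoc, tau0_sq, one_mul]
  simp only [bTildeSet, bSet, bHatSet, Set.mem_setOf_eq, IsPairingOn]
  rw [hat_permOn, hat_sq, hfix, rel_permOn n h, rel_sq h, rel_fix n h, c1, c2]
  constructor
  · rintro ⟨⟨⟨h1, h2, h3⟩, h4, h5, h6, h7⟩, h8, h9⟩
    exact ⟨h3, h9, by omega, h1, h2, (hat_pos ρ n h3).2 ((rel_pos n h h3).1 h7)⟩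
  · rintro ⟨h3, h9, h4, h1, h2, h7⟩
    exact ⟨⟨⟨h1, h2, h3⟩, by omega, rel_comm n h h3, rel_tau0_fix n h h3,
      (rel_pos n h h3).2 ((hat_pos ρ n h3).1 h7)⟩, rel_BSet n h h3, h9⟩

theorem exists_rel {τ : Equiv.Perm ℤ} (n k p : ℕ) (hτ : τ ∈ bTildeSet k p n) :
    ∃ ρ, Rel τ ρ := by
  obtain ⟨⟨⟨h1, h2, h3⟩, h4, h5, h6, h7⟩, h8, h9⟩ := hτ
  have hsq : ∀ y, τ (τ y) = y := fun y => by rw [← Equiv.Perm.mul_apply, h1]; rfl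
  have key : ∀ x, ∃ z, τ (eB x) = eB z := by
    intro x
    by_cases hx : x ∈ pmSet n
    · have := h8 (eB x) ((eB_mem_B n x).2 hx)
      rw [BSet_eq] at this
      obtain ⟨z, -, hz⟩ := Finset.mem_map.1 this
      exact ⟨z, hz.symm⟩
    · exact ⟨x, h3 _ (by rwa [eB_mem_pm])⟩
  choose f hf using key
  have hinv : Function.Involutive f := by
    intro x
    apply eB.injective
    rw [← hf, ← hf, hsq]
  refine ⟨hinv.toPerm, fun x => ⟨?_, hf x⟩⟩
  change τ (eW x) = eW (f x)
  by_cases hx : x ∈ pmSet n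
  · have hfx : f x ∈ pmSet n := by
      rw [← eB_mem_pm, ← hf]
      exact (permOn_mem h3 _).2 ((eB_mem_pm n x).2 hx)
    rw [← tau0_eB n x hx, ← tau0_eB n _ hfx, ← Equiv.Perm.mul_apply, ← h5, Equiv.Perm.mul_apply, hf]
  · have e1 := h3 (eB x) (by rwa [eB_mem_pm])
    have e2 : f x = x := eB.injective ((hf x).symm.trans e1)
    rw [e2]
    exact h3 _ (by rwa [eW_mem_pm])

theorem bijOn_hat (n k p : ℕ) (hn : 1 ≤ n) :
    Set.BijOn (fun σ => dbl (tau0 n * σ)) (bHatSet k p n) (bTildeSet k p n) := by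
  have hc : ∀ σ : Equiv.Perm ℤ, tau0 n * (tau0 n * σ) = σ := fun σ => by
    rw [← mul_assoc, tau0_sq, one_mul]
  have hrel : ∀ σ ∈ bHatSet k p n, Rel (dbl (tau0 n * σ)) (tau0 n * σ) := by
    intro σ hσ
    exact rel_dbl _ ((hat_permOn σ n).2 hσ.1 0 (zero_notMem_pm n))
  refine ⟨?_, ?_, ?_⟩
  · intro σ hσ
    refine (rel_main n k p hn (hrel σ hσ)).2 ?_
    rwa [hc]
  · intro σ hσ σ' hσ' he
    have h1 := hrel σ hσ
    have h2 := hrel σ' hσ'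
    simp only at he
    rw [he] at h1
    exact mul_left_cancel (h1.unique_right h2)
  · intro τ hτ
    obtain ⟨ρ, hρ⟩ := exists_rel n k p hτ
    have hm := (rel_main n k p hn hρ).1 hτ
    refine ⟨tau0 n * ρ, hm, ?_⟩
    have h1 := hrel _ hm
    rw [hc] at h1
    simp only [hc]
    exact h1.unique hρ

/-- For `n ≥ 1`, `k ≥ 1`, `p ≥ 1`, the sets `b̃_{k,p}(n)` and
`b̂_{k,p}(n)` are in bijection; in particular they have the same cardinality. -/
theorem bijection_bTilde_bHat (n k p : ℕ) (hn : 1 ≤ n) (hk : 1 ≤ k) (hp : 1 ≤ p) :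
    (∃ f : Equiv.Perm ℤ → Equiv.Perm ℤ,
      Set.BijOn f (bTildeSet k p n) (bHatSet k p n)) ∧
    (bTildeSet k p n).ncard = (bHatSet k p n).ncard := by
  have h := bijOn_hat n k p hn
  exact ⟨⟨_, Set.BijOn.symm h.invOn_invFunOn.symm h⟩, h.ncard_eq.symm⟩

end RibbonNC
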